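/- arXiv:2304.14806 — 7 statements merged into one kernel-verified Lean document; each statement's English description precedes it below -/
import Mathlib

section
/- Let S be a C-semigroup in ℕ^d with a term order ≺ on ℕ^d. If S is ≺-almost symmetric, then for every g ∈ cone(S) ∩ ℕ^d: g ∈ S if and only if (F(S)_≺ − g ∉ S and g ∉ PF'_≺(S)). -/
open Set

/-- Membership in the rational cone spanned by `S` inside `ℚ^d`. -/
def memCone {d : ℕ} (S : Set (Fin d → ℕ)) (x : Fin d → ℚ) : Prop :=
  ∃ (n : ℕ) (c : Fin n → ℚ) (v : Fin n → (Fin d → ℕ)),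
    (∀ i, 0 ≤ c i) ∧ (∀ i, v i ∈ S) ∧ x = ∑ i, c i • (fun j => ((v i j : ℚ)))

/-- `cone(S) ∩ ℕ^d`, viewed as a subset of `ℕ^d`. -/
def coneN {d : ℕ} (S : Set (Fin d → ℕ)) : Set (Fin d → ℕ) :=
  {x | memCone S (fun j => ((x j : ℚ)))}

/-- `H(S) = (cone(S) \ S) ∩ ℕ^d`. -/
def Hset {d : ℕ} (S : Set (Fin d → ℕ)) : Set (Fin d → ℕ) := coneN S \ S

/-- The set of pseudo-Frobenius elements of `S`. -/
def pfSet {d : ℕ} (S : Set (Fin d → ℕ)) : Set (Fin d → ℕ) :=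
  {f | f ∈ Hset S ∧ ∀ s ∈ S, s ≠ 0 → f + s ∈ S}

/-- A term order on `ℕ^d`: a strict total order compatible with addition. -/
def IsTermOrder {d : ℕ} (prec : (Fin d → ℕ) → (Fin d → ℕ) → Prop) : Prop :=
  (∀ a, ¬ prec a a) ∧ (∀ a b c, prec a b → prec b c → prec a c) ∧
    (∀ a b, a ≠ b → prec a b ∨ prec b a) ∧
    (∀ a b c, prec a b → prec (a + c) (b + c))

/-- `F` is the maximum of `H(S)` with respect to the term order `prec`. -/
def IsFrob {d : ℕ} (S : Set (Fin d → ℕ)) (prec : (Fin d → ℕ) → (Fin d → ℕ) → Prop)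
    (F : Fin d → ℕ) : Prop :=
  F ∈ Hset S ∧ ∀ h ∈ Hset S, h ≠ F → prec h F

/-- A `C`-semigroup: a finitely generated submonoid of `ℕ^d` with
`H(S)` nonempty and finite. -/
def CSemigroup {d : ℕ} (S : AddSubmonoid (Fin d → ℕ)) : Prop :=
  S.FG ∧ (Hset (S : Set (Fin d → ℕ))).Nonempty ∧ (Hset (S : Set (Fin d → ℕ))).Finite

/-- `T` is an ideal of `S`: a subset of `cone(S) ∩ ℕ^d` with `S + T ⊆ T`. -/
def IsIdeal {d : ℕ} (S T : Set (Fin d → ℕ)) : Prop :=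
  T ⊆ coneN S ∧ ∀ s ∈ S, ∀ t ∈ T, s + t ∈ T

/-- `Ω_≺ = {z ∈ cone(S) ∩ ℕ^d : F(S)_≺ − z ∉ S}` (the condition `F − z ∉ S`
is expressed as: there is no `w ∈ S` with `z + w = F`). -/
def omegaSet {d : ℕ} (S : Set (Fin d → ℕ)) (F : Fin d → ℕ) : Set (Fin d → ℕ) :=
  {z ∈ coneN S | ¬ ∃ w ∈ S, z + w = F}

/-- `S` is `≺`-almost symmetric (with Frobenius element `F`):
`PF'(S) = PF(S) \ {F}` is nonempty and `F − g ∈ PF'(S)` for every `g ∈ PF'(S)`. -/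
def AlmostSym {d : ℕ} (S : Set (Fin d → ℕ)) (F : Fin d → ℕ) : Prop :=
  (pfSet S \ {F}).Nonempty ∧ ∀ g ∈ pfSet S \ {F}, ∃ w ∈ pfSet S \ {F}, g + w = F

/-- The unique minimal generating set of a submonoid of `ℕ^d`:
the nonzero elements that are not sums of two nonzero elements. -/
def minGens {d : ℕ} (S : Set (Fin d → ℕ)) : Set (Fin d → ℕ) :=
  {s ∈ S | s ≠ 0 ∧ ¬ ∃ x ∈ S, ∃ y ∈ S, x ≠ 0 ∧ y ≠ 0 ∧ x + y = s}

theorem add_mem_coneN {d : ℕ} {S : Set (Fin d → ℕ)} {x s : Fin d → ℕ}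
    (hx : x ∈ coneN S) (hs : s ∈ S) : x + s ∈ coneN S := by
  obtain ⟨n, c, v, hc, hv, h⟩ := hx
  refine ⟨n + 1, Fin.cons 1 c, Fin.cons s v, ?_, ?_, ?_⟩
  · exact Fin.cases (by simp) (by simpa using hc)
  · exact Fin.cases (by simpa using hs) (by simpa using hv)
  · rw [Fin.sum_univ_succ]
    simp only [Fin.cons_zero, Fin.cons_succ, one_smul]
    rw [← h]
    ext j
    simp [add_comm]

/-- If `H(S)` is finite, every element of `H(S)` can be moved into `PF(S)` by adding an
element of `S`. -/
theorem exists_add_mem_pfSet {d : ℕ} {S : AddSubmonoid (Fin d → ℕ)}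
    (hfin : (Hset (S : Set (Fin d → ℕ))).Finite) {g : Fin d → ℕ}
    (hg : g ∈ Hset (S : Set (Fin d → ℕ))) :
    ∃ s ∈ S, g + s ∈ pfSet (S : Set (Fin d → ℕ)) := by
  have hT : {f ∈ Hset (S : Set (Fin d → ℕ)) | ∃ s ∈ S, g + s = f}.Finite :=
    hfin.subset (sep_subset _ _)
  obtain ⟨f, ⟨hfH, s, hs, rfl⟩, hmax⟩ := hT.exists_maximal ⟨g, hg, 0, S.zero_mem, add_zero g⟩
  refine ⟨s, hs, hfH, fun t ht ht0 => ?_⟩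
  by_contra hnot
  have hle : g + s + t ≤ g + s :=
    hmax ⟨⟨add_mem_coneN hfH.1 ht, hnot⟩, s + t, S.add_mem hs ht, (add_assoc g s t).symm⟩
      le_self_add
  exact ht0 (by simpa using hle)

/-- If a `C`-semigroup `S` is `≺`-almost symmetric, then for every
`g ∈ cone(S) ∩ ℕ^d`: `g ∈ S ↔ (F(S)_≺ − g ∉ S ∧ g ∉ PF'_≺(S))`
(where `F − g ∉ S` is expressed as: there is no `w ∈ S` with `g + w = F`). -/
theorem almostSym_mem_iff {d : ℕ} (S : AddSubmonoid (Fin d → ℕ)) (hC : CSemigroup S)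
    (prec : (Fin d → ℕ) → (Fin d → ℕ) → Prop) (hprec : IsTermOrder prec)
    (F : Fin d → ℕ) (hF : IsFrob (S : Set (Fin d → ℕ)) prec F)
    (hAS : AlmostSym (S : Set (Fin d → ℕ)) F) :
    ∀ g ∈ coneN (S : Set (Fin d → ℕ)),
      (g ∈ S ↔ (¬ ∃ w ∈ S, g + w = F) ∧ g ∉ pfSet (S : Set (Fin d → ℕ)) \ {F}) := by
  intro g hg
  constructor
  · intro hgS
    refine ⟨?_, fun h => h.1.1.2 hgS⟩
    rintro ⟨w, hw, rfl⟩
    exact hF.1.2 (S.add_mem hgS hw)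
  · rintro ⟨hsub, hgPF⟩
    by_contra hgS
    obtain ⟨s, hs, hf⟩ := exists_add_mem_pfSet hC.2.2 ⟨hg, hgS⟩
    have hfF : g + s ≠ F := fun h => hsub ⟨s, hs, h⟩
    obtain ⟨w, hw, hwF⟩ := hAS.2 _ ⟨hf, hfF⟩
    have hs0 : s ≠ 0 := by
      rintro rfl
      rw [add_zero] at hf hfF
      exact hgPF ⟨hf, hfF⟩
    exact hsub ⟨w + s, hw.1.2 s hs hs0, by rw [← hwF, add_assoc, add_comm w s]⟩
end

section
/- Let S be a C-semigroup in ℕ^d with full cone, let ≺ be a term order on ℕ^d, assume PF'_≺(S) ≠ ∅ and f ≼ F(S)_≺ componentwise for all f ∈ PF'_≺(S). If for each g ∈ cone(S) ∩ ℕ^d one has the equivalence (g ∈ S if and only if F(S)_≺ − g ∉ S and g ∉ PF'_≺(S)), then S is ≺-almost symmetric. -/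
open Set

/-- Let `S` be a `C`-semigroup with full cone, `PF'_≺(S) ≠ ∅`, and
`f ≼ F(S)_≺` for all `f ∈ PF'_≺(S)`. If for each `g ∈ cone(S) ∩ ℕ^d` one has
`g ∈ S ↔ (F(S)_≺ − g ∉ S ∧ g ∉ PF'_≺(S))`, then `S` is `≺`-almost symmetric. -/
theorem almostSym_of_mem_iff {d : ℕ} (S : AddSubmonoid (Fin d → ℕ)) (hC : CSemigroup S)
    (hfull : coneN (S : Set (Fin d → ℕ)) = Set.univ)
    (prec : (Fin d → ℕ) → (Fin d → ℕ) → Prop) (hprec : IsTermOrder prec)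
    (F : Fin d → ℕ) (hF : IsFrob (S : Set (Fin d → ℕ)) prec F)
    (hne : (pfSet (S : Set (Fin d → ℕ)) \ {F}).Nonempty)
    (hle : ∀ f ∈ pfSet (S : Set (Fin d → ℕ)) \ {F}, f ≤ F)
    (h : ∀ g ∈ coneN (S : Set (Fin d → ℕ)),
      (g ∈ S ↔ (¬ ∃ w ∈ S, g + w = F) ∧ g ∉ pfSet (S : Set (Fin d → ℕ)) \ {F})) :
    AlmostSym (S : Set (Fin d → ℕ)) F := by
  refine ⟨hne, fun g hg => ?_⟩
  obtain ⟨w, hw⟩ := le_iff_exists_add.mp (hle g hg)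
  have hwS : w ∉ S := fun hwS => by
    refine hF.1.2 (hw ▸ hg.1.2 w hwS ?_)
    rintro rfl
    exact hg.2 (by simpa using hw.symm)
  have hwF : ¬ ∃ v ∈ S, w + v = F := by
    rintro ⟨v, hv, hwv⟩
    have hvg : v = g := add_left_cancel (hwv.trans (hw.trans (add_comm g w)))
    exact hg.1.1.2 (hvg ▸ hv)
  refine ⟨w, ?_, hw.symm⟩
  by_contra hwP
  exact hwS ((h w (hfull ▸ mem_univ w)).mpr ⟨hwF, hwP⟩)
end

section
/- Let S be a C-semigroup in ℕ^d with full cone, let ≺ be a term order on ℕ^d, assume PF'_≺(S) ≠ ∅ and f ≼ F(S)_≺ componentwise for all f ∈ PF'_≺(S). If |H(S) \ PF'_≺(S)| = |{g ∈ S : g ≼ F(S)_≺}|, then S is ≺-almost symmetric. -/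
open Set

/-- Let `S` be a `C`-semigroup with full cone, `PF'_≺(S) ≠ ∅`, and
`f ≼ F(S)_≺` for all `f ∈ PF'_≺(S)`. If
`|H(S) \ PF'_≺(S)| = |{g ∈ S : g ≼ F(S)_≺}|`, then `S` is `≺`-almost symmetric. -/
theorem almostSym_of_card_eq {d : ℕ} (S : AddSubmonoid (Fin d → ℕ)) (hC : CSemigroup S)
    (hfull : coneN (S : Set (Fin d → ℕ)) = Set.univ)
    (prec : (Fin d → ℕ) → (Fin d → ℕ) → Prop) (hprec : IsTermOrder prec)
    (F : Fin d → ℕ) (hF : IsFrob (S : Set (Fin d → ℕ)) prec F)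
    (hne : (pfSet (S : Set (Fin d → ℕ)) \ {F}).Nonempty)
    (hle : ∀ f ∈ pfSet (S : Set (Fin d → ℕ)) \ {F}, f ≤ F)
    (h : (Hset (S : Set (Fin d → ℕ)) \ (pfSet (S : Set (Fin d → ℕ)) \ {F})).ncard =
      {g ∈ (S : Set (Fin d → ℕ)) | g ≤ F}.ncard) :
    AlmostSym (S : Set (Fin d → ℕ)) F := by
  have hH : ∀ x, x ∉ S → x ∈ Hset (S : Set (Fin d → ℕ)) := fun x hx =>
    ⟨hfull ▸ Set.mem_univ x, hx⟩
  have hFS : F ∉ S := hF.1.2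
  have himage : (fun g => F - g) '' {g ∈ (S : Set (Fin d → ℕ)) | g ≤ F} =
      Hset (S : Set (Fin d → ℕ)) \ (pfSet (S : Set (Fin d → ℕ)) \ {F}) := by
    refine Set.eq_of_subset_of_ncard_le ?_ ?_ (hC.2.2.subset Set.sdiff_subset)
    · rintro _ ⟨g, ⟨hgS, hgF⟩, rfl⟩
      have hsub : F - g + g = F := tsub_add_cancel_of_le hgF
      refine ⟨hH _ fun hS => hFS (hsub ▸ S.add_mem hS hgS), fun hpf => ?_⟩
      have hg0 : g ≠ 0 := by
        rintro rfl
        exact hpf.2 (tsub_zero F)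
      exact hFS (hsub ▸ hpf.1.2 g hgS hg0)
    · rw [h, Set.InjOn.ncard_image]
      exact fun a ha b hb hab => (tsub_right_inj ha.2 hb.2).mp hab
  refine ⟨hne, fun f hf => ?_⟩
  have hfF := hle f hf
  have hadd : f + (F - f) = F := add_tsub_cancel_of_le hfF
  refine ⟨F - f, ?_, hadd⟩
  by_contra hnot
  have hwS : F - f ∉ S := fun hS => by
    have hw0 : F - f ≠ 0 := fun h0 => hf.2 (by rw [h0, add_zero] at hadd; exact hadd)
    exact hFS (hadd ▸ hf.1.2 _ hS hw0)
  obtain ⟨g, ⟨hgS, hgF⟩, hg⟩ := himage.superset ⟨hH _ hwS, hnot⟩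
  exact hf.1.1.2 ((tsub_right_inj hgF hfF).mp hg ▸ hgS)
end

section
/- Let a ≥ 3 be an odd natural number, p ≥ 1 an integer, and let S_{a,p} be the submonoid of ℕ² generated by (a,0), (0,a^p), (a+2,2), (2,2+a^p). Then Ap(S_{a,p}, {(a,0),(0,a^p)}) = {α(a+2,2) + α'(2,2+a^p) : α, α' ∈ ℕ, α + α' < a^p}, where Ap(S,E) = {b ∈ S : b − e ∉ S for all e ∈ E} (differences taken in ℤ²). -/
open Set

/-- The Apéry set of a subset `E` of a submonoid `S ⊆ ℕ^d`:
`Ap(S, E) = {b ∈ S : b − e ∉ S for all e ∈ E}` (the condition `b − e ∉ S` is expressed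
as: there is no `w ∈ S` with `e + w = b`). -/
def apSet {d : ℕ} (S : Set (Fin d → ℕ)) (E : Set (Fin d → ℕ)) : Set (Fin d → ℕ) :=
  {b ∈ S | ∀ e ∈ E, ¬ ∃ w ∈ S, e + w = b}

/-- The affine semigroup `S_{a,p} = ⟨(a,0), (0,a^p), (a+2,2), (2,2+a^p)⟩ ⊆ ℕ²`. -/
def Sap (a p : ℕ) : AddSubmonoid (Fin 2 → ℕ) :=
  AddSubmonoid.closure {![a, 0], ![0, a ^ p], ![a + 2, 2], ![2, 2 + a ^ p]}

/-- Elements of `Sap a p` are the nonnegative integer combinations of its four generators. -/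
theorem mem_Sap_iff {a p : ℕ} {x : Fin 2 → ℕ} :
    x ∈ Sap a p ↔ ∃ l m α β : ℕ,
      x 0 = a * (l + α) + 2 * (α + β) ∧ x 1 = a ^ p * (m + β) + 2 * (α + β) := by
  constructor
  · intro hx
    induction hx using AddSubmonoid.closure_induction with
    | mem x hx =>
      rcases hx with rfl | rfl | rfl | rfl
      · exact ⟨1, 0, 0, 0, by simp, by simp⟩
      · exact ⟨0, 1, 0, 0, by simp, by simp⟩
      · exact ⟨0, 0, 1, 0, by simp, by simp⟩
      · exact ⟨0, 0, 0, 1, by simp, by simp [add_comm]⟩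
    | zero => exact ⟨0, 0, 0, 0, by simp, by simp⟩
    | add x y _ _ hx hy =>
      obtain ⟨l, m, α, β, h0, h1⟩ := hx
      obtain ⟨l', m', α', β', h0', h1'⟩ := hy
      exact ⟨l + l', m + m', α + α', β + β', by rw [Pi.add_apply, h0, h0']; ring,
        by rw [Pi.add_apply, h1, h1']; ring⟩
  · rintro ⟨l, m, α, β, h0, h1⟩
    have hx : x = l • ![a, 0] + m • ![0, a ^ p] + α • ![a + 2, 2] + β • ![2, 2 + a ^ p] := by
      ext i
      fin_cases i
      · simp [h0]; ring
      · simp [h1]; ring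
    rw [hx]
    have hg : ∀ g ∈ ({![a, 0], ![0, a ^ p], ![a + 2, 2], ![2, 2 + a ^ p]} : Set (Fin 2 → ℕ)),
        g ∈ Sap a p := fun g hg => AddSubmonoid.subset_closure hg
    exact add_mem (add_mem (add_mem (nsmul_mem (hg _ (by simp)) l) (nsmul_mem (hg _ (by simp)) m))
      (nsmul_mem (hg _ (by simp)) α)) (nsmul_mem (hg _ (by simp)) β)

/-- If an element is a combination of the last two generators with fewer than `a * r` summands,
then every representation of it has coefficients zero at the first two generators. Here `a * r`
stands for `a ^ p`. -/
theorem eq_zero_of_representation_eq {a r α β l m γ δ : ℕ} (ha : 0 < a) (hr : 0 < r)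
    (hodd : Odd (a * r)) (hlt : α + β < a * r)
    (h0 : a * (l + γ) + 2 * (γ + δ) = a * α + 2 * (α + β))
    (h1 : a * r * (m + δ) + 2 * (γ + δ) = a * r * β + 2 * (α + β)) : l = 0 ∧ m = 0 := by
  have hmod : γ + δ ≡ α + β [MOD a * r] := by
    refine Nat.ModEq.cancel_left_of_coprime (c := 2) (Nat.coprime_two_right.mpr hodd) ?_
    have h := congrArg (· % (a * r)) h1
    simpa [Nat.ModEq, Nat.mul_add_mod] using h
  have hdiv := Nat.div_add_mod (γ + δ) (a * r)
  rw [show _ % _ = _ % _ from hmod, Nat.mod_eq_of_lt hlt] at hdiv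
  generalize (γ + δ) / (a * r) = k at hdiv
  have e0 : l + γ + 2 * (r * k) = α := by
    refine Nat.eq_of_mul_eq_mul_left ha ?_
    nlinarith
  have e1 : m + δ + 2 * k = β := by
    refine Nat.eq_of_mul_eq_mul_left (Nat.mul_pos ha hr) ?_
    nlinarith
  omega

/-- For odd `a ≥ 3` and `p ≥ 1`,
`Ap(S_{a,p}, {(a,0), (0,a^p)}) = {α(a+2,2) + α'(2,2+a^p) : α + α' < a^p}`. -/
theorem apSet_Sap (a p : ℕ) (ha : 3 ≤ a) (hodd : Odd a) (hp : 1 ≤ p) :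
    apSet ((Sap a p : AddSubmonoid (Fin 2 → ℕ)) : Set (Fin 2 → ℕ))
        {![a, 0], ![0, a ^ p]} =
      {x | ∃ α α' : ℕ, α + α' < a ^ p ∧
        x = α • ![a + 2, 2] + α' • ![2, 2 + a ^ p]} := by
  obtain ⟨r, hr⟩ : a ∣ a ^ p := dvd_pow_self a (by omega)
  have hq : 0 < a ^ p := by positivity
  have hrpos : 0 < r := Nat.pos_of_mul_pos_left (hr ▸ hq)
  ext x
  simp only [apSet, mem_ofPred_eq, SetLike.mem_coe, mem_insert_iff, mem_singleton_iff,
    forall_eq_or_imp, forall_eq]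
  constructor
  · rintro ⟨hx, hA, hB⟩
    obtain ⟨l, m, α, β, h0, h1⟩ := mem_Sap_iff.mp hx
    have hl : l = 0 := by
      by_contra hl
      obtain ⟨l, rfl⟩ := Nat.exists_eq_succ_of_ne_zero hl
      refine hA ⟨![a * (l + α) + 2 * (α + β), x 1],
        mem_Sap_iff.mpr ⟨l, m, α, β, by simp, by simp [h1]⟩, ?_⟩
      ext i
      fin_cases i
      · simp [h0]; ring
      · simp
    have hm : m = 0 := by
      by_contra hm
      obtain ⟨m, rfl⟩ := Nat.exists_eq_succ_of_ne_zero hm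
      refine hB ⟨![x 0, a ^ p * (m + β) + 2 * (α + β)],
        mem_Sap_iff.mpr ⟨l, m, α, β, by simp [h0], by simp⟩, ?_⟩
      ext i
      fin_cases i
      · simp
      · simp [h1]; ring
    subst hl hm
    refine ⟨α, β, ?_, ?_⟩
    · by_contra! hle
      obtain ⟨γ, δ, γ', δ', rfl, rfl, hsum⟩ : ∃ γ δ γ' δ' : ℕ,
          α = γ + γ' ∧ β = δ + δ' ∧ γ' + δ' = a ^ p :=
        ⟨α - min α (a ^ p), β - (a ^ p - min α (a ^ p)), min α (a ^ p), a ^ p - min α (a ^ p),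
          by omega, by omega, by omega⟩
      refine hB ⟨![x 0, a ^ p * (δ' + 1 + δ) + 2 * (γ + δ)],
        mem_Sap_iff.mpr ⟨γ' + 2 * r, δ' + 1, γ, δ, ?_, by simp⟩, ?_⟩
      · simp only [Matrix.cons_val_zero, h0]
        linear_combination 2 * hsum + 2 * hr
      · ext i
        fin_cases i
        · simp
        · simp [h1]
          linear_combination 2 * hsum.symm
    · ext i
      fin_cases i
      · simp [h0]; ring
      · simp [h1]; ring
  · rintro ⟨α, β, hlt, rfl⟩
    have hodd' : Odd (a * r) := hr ▸ hodd.pow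
    rw [hr] at hlt
    refine ⟨mem_Sap_iff.mpr ⟨0, 0, α, β, by simp; ring, by simp; ring⟩, ?_, ?_⟩
    · rintro ⟨w, hw, h⟩
      obtain ⟨l, m, γ, δ, h0, h1⟩ := mem_Sap_iff.mp hw
      have e0 := congrFun h 0
      have e1 := congrFun h 1
      simp [h0, h1, hr] at e0 e1
      have := (eq_zero_of_representation_eq (l := l + 1) (m := m) (γ := γ) (δ := δ) (by omega)
        hrpos hodd' hlt (by linear_combination e0) (by linear_combination e1)).1
      omega
    · rintro ⟨w, hw, h⟩
      obtain ⟨l, m, γ, δ, h0, h1⟩ := mem_Sap_iff.mp hw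
      have e0 := congrFun h 0
      have e1 := congrFun h 1
      simp [h0, h1, hr] at e0 e1
      have := (eq_zero_of_representation_eq (l := l) (m := m + 1) (γ := γ) (δ := δ) (by omega)
        hrpos hodd' hlt (by linear_combination e0) (by linear_combination e1)).2
      omega
end

section
/- Let S be a submonoid of ℕ^d and let a ∈ S \ {0}. Then S is an Arf monoid if and only if (a + S) ∪ {0} is an Arf monoid. -/
open Set

/-- A subset `S ⊆ ℕ^d` is Arf if for all `x, y, z ∈ S` with `x ≼ y ≼ z` (componentwise),
`y + z − x ∈ S` (the difference is computed componentwise; it lies in `ℕ^d` since `x ≼ y`). -/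
def IsArf {d : ℕ} (S : Set (Fin d → ℕ)) : Prop :=
  ∀ x ∈ S, ∀ y ∈ S, ∀ z ∈ S, x ≤ y → y ≤ z → y + z - x ∈ S

/-- `S' = {y + z − x : x, y, z ∈ S, x ≼ y ≼ z}`. -/
def arfDeriv {d : ℕ} (S : Set (Fin d → ℕ)) : Set (Fin d → ℕ) :=
  {w | ∃ x ∈ S, ∃ y ∈ S, ∃ z ∈ S, x ≤ y ∧ y ≤ z ∧ w = y + z - x}

/-- Let `S` be a submonoid of `ℕ^d` and `a ∈ S \ {0}`. Then `S` is an
Arf monoid if and only if `(a + S) ∪ {0}` is an Arf monoid. -/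
theorem isArf_iff_isArf_translate {d : ℕ} (S : AddSubmonoid (Fin d → ℕ))
    (a : Fin d → ℕ) (ha : a ∈ S) (ha0 : a ≠ 0) :
    IsArf (S : Set (Fin d → ℕ)) ↔
      IsArf ((fun s => a + s) '' (S : Set (Fin d → ℕ)) ∪ {0}) := by
  have ne_zero : ∀ s : Fin d → ℕ, a + s ≠ 0 := fun s h => ha0 (add_eq_zero.mp h).1
  have not_le_zero : ∀ s : Fin d → ℕ, ¬ a + s ≤ 0 := fun s h =>
    ne_zero s (le_antisymm h zero_le)
  have translate_add_sub : ∀ x y z : Fin d → ℕ, x ≤ y →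
      a + y + (a + z) - (a + x) = a + (y + z - x) := by
    intro x y z hxy
    ext i
    have : x i ≤ y i := hxy i
    simp only [Pi.add_apply, Pi.sub_apply]
    omega
  constructor
  · rintro h x (⟨s, hs, rfl⟩ | rfl) y (⟨t, ht, rfl⟩ | rfl) z (⟨u, hu, rfl⟩ | rfl) hxy hyz
    · have hst : s ≤ t := le_of_add_le_add_left hxy
      have htu : t ≤ u := le_of_add_le_add_left hyz
      exact Or.inl ⟨t + u - s, h s hs t ht u hu hst htu, (translate_add_sub s t u hst).symm⟩
    · exact absurd hyz (not_le_zero t)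
    · exact absurd hxy (not_le_zero s)
    · exact absurd hxy (not_le_zero s)
    · refine Or.inl ⟨t + (a + u), S.add_mem ht (S.add_mem ha hu), ?_⟩
      simp [add_assoc]
    · exact absurd hyz (not_le_zero t)
    · exact Or.inl ⟨u, hu, by simp⟩
    · exact Or.inr (by simp)
  · intro h x hx y hy z hz hxy hyz
    have key := h (a + x) (Or.inl ⟨x, hx, rfl⟩) (a + y) (Or.inl ⟨y, hy, rfl⟩)
      (a + z) (Or.inl ⟨z, hz, rfl⟩) (by gcongr) (by gcongr)
    rw [translate_add_sub x y z hxy] at key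
    rcases key with ⟨t, ht, hta⟩ | h0
    · exact add_left_cancel hta ▸ ht
    · exact absurd h0 (ne_zero _)
end

section
/- Let S be a submonoid of ℕ^d that is contained in only finitely many submonoids of ℕ^d. Then there exists i ∈ ℕ such that S^i = Arf(S), where S^0 = S and S^{k+1} = (S^k)'. -/
open Set

/-- The Arf closure of `S`: the intersection of all Arf submonoids of `ℕ^d` containing `S`. -/
def arfClosure {d : ℕ} (S : AddSubmonoid (Fin d → ℕ)) : Set (Fin d → ℕ) :=
  ⋂ T ∈ {T : AddSubmonoid (Fin d → ℕ) | IsArf (T : Set (Fin d → ℕ)) ∧ S ≤ T},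
    (T : Set (Fin d → ℕ))

/-- The derivation `S ↦ S'` as an operation on submonoids of `ℕ^d`. -/
def arfDerivSubmonoid {d : ℕ} (S : AddSubmonoid (Fin d → ℕ)) : AddSubmonoid (Fin d → ℕ) where
  carrier := arfDeriv (S : Set (Fin d → ℕ))
  zero_mem' := ⟨0, S.zero_mem, 0, S.zero_mem, 0, S.zero_mem, le_rfl, le_rfl, by simp⟩
  add_mem' := by
    rintro _ _ ⟨x, hx, y, hy, z, hz, hxy, hyz, rfl⟩ ⟨x', hx', y', hy', z', hz', hxy', hyz', rfl⟩
    refine ⟨x + x', S.add_mem hx hx', y + y', S.add_mem hy hy', z + z', S.add_mem hz hz',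
      add_le_add hxy hxy', add_le_add hyz hyz', ?_⟩
    ext i
    have h : x i ≤ y i := hxy i
    have h' : x' i ≤ y' i := hxy' i
    simp only [Pi.add_apply, Pi.sub_apply]
    omega

theorem coe_arfDerivSubmonoid {d : ℕ} (S : AddSubmonoid (Fin d → ℕ)) :
    (arfDerivSubmonoid S : Set (Fin d → ℕ)) = arfDeriv (S : Set (Fin d → ℕ)) := rfl

theorem coe_iterate_arfDerivSubmonoid {d : ℕ} (S : AddSubmonoid (Fin d → ℕ)) (n : ℕ) :
    (arfDerivSubmonoid^[n] S : Set (Fin d → ℕ)) = arfDeriv^[n] (S : Set (Fin d → ℕ)) :=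
  Function.Semiconj.iterate_right coe_arfDerivSubmonoid n S

theorem le_arfDerivSubmonoid {d : ℕ} (S : AddSubmonoid (Fin d → ℕ)) :
    S ≤ arfDerivSubmonoid S := fun w hw =>
  ⟨0, S.zero_mem, 0, S.zero_mem, w, hw, le_rfl, zero_le, by simp⟩

theorem arfDerivSubmonoid_le_of_isArf {d : ℕ} {S T : AddSubmonoid (Fin d → ℕ)}
    (hT : IsArf (T : Set (Fin d → ℕ))) (hST : S ≤ T) : arfDerivSubmonoid S ≤ T := by
  rintro _ ⟨x, hx, y, hy, z, hz, hxy, hyz, rfl⟩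
  exact hT x (hST hx) y (hST hy) z (hST hz) hxy hyz

theorem isArf_of_arfDerivSubmonoid_le {d : ℕ} {S : AddSubmonoid (Fin d → ℕ)}
    (h : arfDerivSubmonoid S ≤ S) : IsArf (S : Set (Fin d → ℕ)) :=
  fun x hx y hy z hz hxy hyz => h ⟨x, hx, y, hy, z, hz, hxy, hyz, rfl⟩

theorem monotone_iterate_arfDerivSubmonoid {d : ℕ} (S : AddSubmonoid (Fin d → ℕ)) :
    Monotone fun n => arfDerivSubmonoid^[n] S :=
  monotone_nat_of_le_succ fun n => by
    rw [Function.iterate_succ_apply']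
    exact le_arfDerivSubmonoid _

theorem iterate_arfDerivSubmonoid_le_of_isArf {d : ℕ} {S T : AddSubmonoid (Fin d → ℕ)}
    (hT : IsArf (T : Set (Fin d → ℕ))) (hST : S ≤ T) (n : ℕ) :
    arfDerivSubmonoid^[n] S ≤ T := by
  induction n with
  | zero => exact hST
  | succ n ih =>
    rw [Function.iterate_succ_apply']
    exact arfDerivSubmonoid_le_of_isArf hT ih

/-- If a submonoid `S` of `ℕ^d` is contained in only finitely many
submonoids of `ℕ^d`, then there exists `i ∈ ℕ` with `S^i = Arf(S)`, where `S^0 = S`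
and `S^{k+1} = (S^k)'`. -/
theorem iterate_arfDeriv_eq_arfClosure {d : ℕ} (S : AddSubmonoid (Fin d → ℕ))
    (hfin : {T : AddSubmonoid (Fin d → ℕ) | S ≤ T}.Finite) :
    ∃ i : ℕ, arfDeriv^[i] (S : Set (Fin d → ℕ)) = arfClosure S := by
  have hmono := monotone_iterate_arfDerivSubmonoid S
  obtain ⟨m, n, hmn, heq⟩ := hfin.exists_lt_map_eq_of_forall_mem
    (f := fun n => arfDerivSubmonoid^[n] S) fun n => hmono n.zero_le
  have hArf : IsArf (arfDerivSubmonoid^[m] S : Set (Fin d → ℕ)) := by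
    apply isArf_of_arfDerivSubmonoid_le
    rw [← Function.iterate_succ_apply' arfDerivSubmonoid]
    exact (hmono (Nat.succ_le_of_lt hmn)).trans heq.ge
  refine ⟨m, ?_⟩
  rw [← coe_iterate_arfDerivSubmonoid]
  apply Set.Subset.antisymm
  · exact Set.subset_iInter₂ fun T hT => iterate_arfDerivSubmonoid_le_of_isArf hT.1 hT.2 m
  · exact Set.biInter_subset_of_mem ⟨hArf, hmono m.zero_le⟩
end

section
/- Let S be a submonoid of ℕ^d such that m(S), the infimum of S \ {0} with respect to the componentwise partial order on ℕ^d, belongs to S \ {0}. Then S is a PI-monoid if and only if for all x, y ∈ S \ {0}, the element x + y − m(S) belongs to S \ {0}. -/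
open Set

/-- `S` is a PI-monoid: `S = (a + T) ∪ {0}` for some submonoid `T` of `ℕ^d` and
some `a ∈ T \ {0}`. -/
def IsPIMonoid {d : ℕ} (S : Set (Fin d → ℕ)) : Prop :=
  ∃ T : AddSubmonoid (Fin d → ℕ), ∃ a ∈ T, a ≠ 0 ∧
    S = (fun t => a + t) '' (T : Set (Fin d → ℕ)) ∪ {0}

/-- Let `S` be a submonoid of `ℕ^d` whose multiplicity `m(S)` (the
componentwise infimum of `S \ {0}`) belongs to `S \ {0}`. Then `S` is a PI-monoid if
and only if `x + y − m(S) ∈ S \ {0}` for all `x, y ∈ S \ {0}`. -/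
theorem isPIMonoid_iff {d : ℕ} (S : AddSubmonoid (Fin d → ℕ)) (m : Fin d → ℕ)
    (hm : m ∈ S) (hm0 : m ≠ 0) (hmin : ∀ s ∈ S, s ≠ 0 → m ≤ s) :
    IsPIMonoid (S : Set (Fin d → ℕ)) ↔
      ∀ x ∈ S, x ≠ 0 → ∀ y ∈ S, y ≠ 0 → (x + y - m ∈ S ∧ x + y - m ≠ 0) := by
  have add_ne_zero : ∀ t, m + t ≠ 0 := fun t ht =>
    hm0 (le_antisymm (ht ▸ le_self_add) zero_le)
  have add_add_sub : ∀ t u, m + t + (m + u) - m = m + (t + u) := fun t u => by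
    rw [add_assoc, add_tsub_cancel_left, add_left_comm]
  constructor
  · rintro ⟨T, a, -, ha0, hS⟩
    have mem_iff : ∀ s, s ∈ S ↔ s = 0 ∨ ∃ t ∈ T, a + t = s := fun s => by
      rw [← SetLike.mem_coe, hS]
      simp
    have exists_eq : ∀ s ∈ S, s ≠ 0 → ∃ t ∈ T, a + t = s := fun s hs hs0 =>
      ((mem_iff s).1 hs).resolve_left hs0
    have haS : a ∈ S := (mem_iff a).2 (Or.inr ⟨0, T.zero_mem, add_zero a⟩)
    obtain rfl : m = a := by
      obtain ⟨t, -, ht⟩ := exists_eq m hm hm0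
      exact le_antisymm (hmin a haS ha0) (ht ▸ le_self_add)
    intro x hx hx0 y hy hy0
    obtain ⟨t, ht, rfl⟩ := exists_eq x hx hx0
    obtain ⟨u, hu, rfl⟩ := exists_eq y hy hy0
    rw [add_add_sub]
    exact ⟨(mem_iff _).2 (Or.inr ⟨t + u, T.add_mem ht hu, rfl⟩), add_ne_zero _⟩
  · intro h
    let T : AddSubmonoid (Fin d → ℕ) :=
      { carrier := {t | m + t ∈ S}
        zero_mem' := by simpa using hm
        add_mem' := fun {t u} ht hu => by
          rw [Set.mem_ofPred_eq, ← add_add_sub]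
          exact (h _ ht (add_ne_zero t) _ hu (add_ne_zero u)).1 }
    refine ⟨T, m, S.add_mem hm hm, hm0, Set.Subset.antisymm (fun s hs => ?_) ?_⟩
    · by_cases hs0 : s = 0
      · exact Or.inr hs0
      · have hms : m + (s - m) = s := add_tsub_cancel_of_le (hmin s hs hs0)
        exact Or.inl ⟨s - m, show m + (s - m) ∈ S from hms.symm ▸ hs, hms⟩
    · rintro s (⟨t, ht, rfl⟩ | rfl)
      · exact ht
      · exact S.zero_mem
end
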